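/- arXiv:1504.06240 — 4 statements merged into one kernel-verified Lean document; each statement's English description precedes it below -/
import Mathlib

section
/- For every nonempty binary string s, the algorithmic probability of s under the program encoding, namely the sum of 2^(−|p|) over all binary encodings p of programs whose output is s, equals m(s) = Σ_{n=1}^∞ (|{τ ∈ (n,2) : τ(0) = s}| + |{τ ∈ (n,2) : τ(1) = s}|) / 2^(n+1+⌈log₂((4n+2)^(2n))⌉). In particular a machine producing s on both blank symbols contributes twice, once for each blank symbol. -/
/-- An instruction of a Busy Beaver machine: `Sum.inl b` means "write `b` and move to the
halting state (no head movement)"; `Sum.inr (q, b, d)` means "write `b`, move the head in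
direction `d` (`true` = right, `false` = left) and change to state `q`".  For the class
`(n,2)` there are `4 * n + 2` instructions. -/
abbrev Instr (n : ℕ) := Bool ⊕ (Fin n × Bool × Bool)

/-- A Turing machine in the class `(n,2)`: a transition table assigning an instruction to
every pair (current state, read symbol). -/
abbrev Machine (n : ℕ) := (Fin n × Bool) → Instr n

/-- A configuration: current state (`none` = halted), tape contents, head position, and the
interval `[lo, hi]` of cells visited so far by the head. -/
structure Config (n : ℕ) where
  state : Option (Fin n)
  tape : ℤ → Bool
  pos : ℤ
  lo : ℤ
  hi : ℤ

/-- One computation step. -/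
def step {n : ℕ} (M : Machine n) (c : Config n) : Config n :=
  match c.state with
  | none => c
  | some q =>
    match M (q, c.tape c.pos) with
    | Sum.inl b => { c with state := none, tape := Function.update c.tape c.pos b }
    | Sum.inr (q', b, d) =>
      let p := c.pos + (if d then 1 else -1)
      { state := some q', tape := Function.update c.tape c.pos b,
        pos := p, lo := min c.lo p, hi := max c.hi p }

/-- The initial configuration on a tape uniformly filled with the blank symbol `i`,
started in the initial state (state `⟨0, _⟩`, i.e. state "1" of `{1,…,n}`). -/
def initConfig (n : ℕ) (i : Bool) : Config n :=
  { state := if h : 0 < n then some ⟨0, h⟩ else none,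
    tape := fun _ => i, pos := 0, lo := 0, hi := 0 }

/-- The configuration after `t` steps of the run `τ(i)`. -/
def cfgAt {n : ℕ} (M : Machine n) (i : Bool) (t : ℕ) : Config n :=
  (step M)^[t] (initConfig n i)

/-- A configuration is halted when the machine has entered the halting state. -/
def Halted {n : ℕ} (c : Config n) : Prop := c.state = none

/-- The output read off a configuration: the symbols in the cells visited by the head. -/
def outputOf {n : ℕ} (c : Config n) : List Bool :=
  (List.range (c.hi - c.lo + 1).toNat).map fun j => c.tape (c.lo + j)

/-- `Outputs M i s` : the run `τ(i)` of `M` on blank symbol `i` halts with output `s`. -/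
def Outputs {n : ℕ} (M : Machine n) (i : Bool) (s : List Bool) : Prop :=
  ∃ t, Halted (cfgAt M i t) ∧ outputOf (cfgAt M i t) = s

/-- `|{τ ∈ (n,2) : τ(i) = s}|`. -/
noncomputable def numOutput (n : ℕ) (i : Bool) (s : List Bool) : ℕ :=
  Nat.card {τ : Machine n // Outputs τ i s}

/-- The exponent `n + 1 + ⌈log₂((4n+2)^(2n))⌉` (the length of the program encodings
with `n` states). -/
def expo (n : ℕ) : ℕ := n + 1 + Nat.clog 2 ((4 * n + 2) ^ (2 * n))

/-- The `n`-th term of the series defining `m(s)`. -/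
noncomputable def mTerm (n : ℕ) (s : List Bool) : ℝ :=
  ((numOutput n false s + numOutput n true s : ℕ) : ℝ) / 2 ^ expo n

/-- The measure `m(s) = Σ_{n=1}^∞ (|{τ ∈ (n,2) : τ(0)=s}| + |{τ ∈ (n,2) : τ(1)=s}|) /
2^(n+1+⌈log₂((4n+2)^(2n))⌉)`. -/
noncomputable def mDist (s : List Bool) : ℝ := ∑' j : ℕ, mTerm (j + 1) s

/-- The finite approximation `m_k(s)`: the same sum truncated to `1 ≤ n ≤ k`. -/
noncomputable def mApprox (k : ℕ) (s : List Bool) : ℝ :=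
  ∑ n ∈ Finset.Icc 1 k, mTerm n s

/-- The finite approximation `m_k(s)` as a rational number. -/
noncomputable def mApproxQ (k : ℕ) (s : List Bool) : ℚ :=
  ∑ n ∈ Finset.Icc 1 k,
    ((numOutput n false s + numOutput n true s : ℕ) : ℚ) / 2 ^ expo n

/-- A program `⟨n, i, t⟩` : `n ≥ 1` states, blank symbol `i`, and machine number
`t < (4n+2)^(2n)`. -/
structure Program where
  n : ℕ
  hn : 1 ≤ n
  i : Bool
  t : ℕ
  ht : t < (4 * n + 2) ^ (2 * n)

/-- The number `t` written in exactly `L` bits. -/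
def natToBits (L t : ℕ) : List Bool := (List.range L).map fun j => t.testBit j

/-- The binary encoding of a program: `1^(n-1) 0`, then the bit `i`, then `t` written in
exactly `⌈log₂((4n+2)^(2n))⌉` bits. -/
def encodeProg (p : Program) : List Bool :=
  List.replicate (p.n - 1) true ++ [false] ++ [p.i] ++
    natToBits (Nat.clog 2 ((4 * p.n + 2) ^ (2 * p.n))) p.t

theorem length_encodeProg (p : Program) : (encodeProg p).length = expo p.n := by
  have := p.hn
  simp only [encodeProg, natToBits, expo, List.length_append, List.length_replicate,
    List.length_map, List.length_range, List.length_singleton]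
  omega

/-- The program with `j + 1` states running the machine `τ` on the blank symbol `i`. -/
def programOfMachine (e : ∀ n, Fin ((4 * n + 2) ^ (2 * n)) ≃ Machine n) (s : List Bool)
    (x : Σ j : ℕ, Σ i : Bool, {τ : Machine (j + 1) // Outputs τ i s}) :
    {p : Program // Outputs (e p.n ⟨p.t, p.ht⟩) p.i s} :=
  ⟨⟨x.1 + 1, Nat.le_add_left 1 x.1, x.2.1, (e (x.1 + 1)).symm x.2.2.1,
      ((e (x.1 + 1)).symm x.2.2.1).isLt⟩, by simpa using x.2.2.2⟩

theorem programOfMachine_bijective (e : ∀ n, Fin ((4 * n + 2) ^ (2 * n)) ≃ Machine n)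
    (s : List Bool) : Function.Bijective (programOfMachine e s) := by
  constructor
  · rintro ⟨j, i, τ, hτ⟩ ⟨j', i', τ', hτ'⟩ h
    simp only [programOfMachine, Subtype.mk.injEq, Program.mk.injEq, Nat.add_right_cancel_iff] at h
    obtain ⟨rfl, rfl, h⟩ := h
    obtain rfl := (e (j + 1)).symm.injective (Fin.ext h)
    rfl
  · rintro ⟨⟨n, hn, i, t, ht⟩, hp⟩
    obtain ⟨j, rfl⟩ := Nat.exists_eq_add_of_le' hn
    exact ⟨⟨j, i, e (j + 1) ⟨t, ht⟩, hp⟩, by simp [programOfMachine]⟩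

theorem tsum_const_outputs (n : ℕ) (i : Bool) (s : List Bool) (c : ENNReal) :
    ∑' _ : {τ : Machine n // Outputs τ i s}, c = numOutput n i s * c := by
  simp [ENNReal.tsum_const, numOutput, ENat.card_eq_coe_natCard]

theorem toReal_mTerm (n : ℕ) (s : List Bool) :
    (∑' i : Bool, ∑' _ : {τ : Machine n // Outputs τ i s},
      ((2 : ENNReal) ^ expo n)⁻¹).toReal = mTerm n s := by
  simp only [tsum_const_outputs, tsum_bool, ← add_mul]
  rw [← Nat.cast_add, ENNReal.toReal_mul, ENNReal.toReal_natCast, ENNReal.toReal_inv,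
    ENNReal.toReal_pow, ENNReal.toReal_ofNat, mTerm, div_eq_mul_inv]

/-- For any enumeration of the machine classes and any nonempty string `s`, the sum of
`2^(-|p|)` over the binary encodings `p` of programs whose output is `s` equals `m(s)`. -/
theorem algorithmic_probability_eq_mDist
    (e : ∀ n, Fin ((4 * n + 2) ^ (2 * n)) ≃ Machine n)
    (s : List Bool) (hs : s ≠ []) :
    (∑' p : {p : Program // Outputs (e p.n ⟨p.t, p.ht⟩) p.i s},
        ((2 : ℝ) ^ (encodeProg p.val).length)⁻¹) = mDist s := by
  have hfin : ∀ n : ℕ, ∑' i : Bool, ∑' _ : {τ : Machine n // Outputs τ i s},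
      ((2 : ENNReal) ^ expo n)⁻¹ ≠ ⊤ := fun n ↦ by
    simp only [tsum_const_outputs, tsum_bool]
    finiteness
  calc
    _ = (∑' p : {p : Program // Outputs (e p.n ⟨p.t, p.ht⟩) p.i s},
          ((2 : ENNReal) ^ expo p.val.n)⁻¹).toReal := by
      rw [ENNReal.tsum_toReal_eq fun _ ↦ by simp]
      simp [length_encodeProg]
    _ = (∑' j : ℕ, ∑' i : Bool, ∑' _ : {τ : Machine (j + 1) // Outputs τ i s},
          ((2 : ENNReal) ^ expo (j + 1))⁻¹).toReal := by
      rw [← (Equiv.ofBijective _ (programOfMachine_bijective e s)).tsum_eq, ENNReal.tsum_sigma']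
      simp only [ENNReal.tsum_sigma']
      rfl
    _ = mDist s := by
      rw [ENNReal.tsum_toReal_eq fun j ↦ hfin (j + 1), mDist]
      simp only [toReal_mTerm]
end

section
/- For every k ≥ 1, the total error of the finite approximation m_k is bounded by 2^(−k): the sum over all nonempty binary strings s of |m(s) − m_k(s)| is at most 1/2^k. -/
theorem cfgAt_eq_of_halted {n : ℕ} {M : Machine n} {i : Bool} {t u : ℕ}
    (h : Halted (cfgAt M i t)) (htu : t ≤ u) : cfgAt M i u = cfgAt M i t := by
  induction u, htu using Nat.le_induction with
  | base => rfl
  | succ u _ ih =>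
    have hs : cfgAt M i (u + 1) = step M (cfgAt M i u) := Function.iterate_succ_apply' ..
    rw [hs, ih]
    unfold Halted at h
    simp [step, h]

theorem Outputs.unique {n : ℕ} {M : Machine n} {i : Bool} {s s' : List Bool}
    (h : Outputs M i s) (h' : Outputs M i s') : s = s' := by
  obtain ⟨t, ht, rfl⟩ := h
  obtain ⟨u, hu, rfl⟩ := h'
  rcases le_total t u with htu | hut
  · rw [cfgAt_eq_of_halted ht htu]
  · rw [cfgAt_eq_of_halted hu hut]

theorem card_machine (n : ℕ) : Fintype.card (Machine n) = (4 * n + 2) ^ (2 * n) := by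
  simp only [Fintype.card_fun, Fintype.card_sum, Fintype.card_prod, Fintype.card_bool,
    Fintype.card_fin]
  congr 1 <;> ring

theorem sum_numOutput_le (n : ℕ) (i : Bool) (F : Finset (List Bool)) :
    ∑ s ∈ F, numOutput n i s ≤ (4 * n + 2) ^ (2 * n) := by
  classical
  have hcard (s : List Bool) :
      numOutput n i s = (Finset.univ.filter fun τ : Machine n => Outputs τ i s).card := by
    rw [numOutput, Nat.card_eq_fintype_card, Fintype.card_subtype]
  simp_rw [hcard]
  rw [← Finset.card_biUnion, ← card_machine]
  · exact Finset.card_le_univ _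
  · intro s _ s' _ hne
    refine Finset.disjoint_filter.2 fun τ _ h h' => hne (h.unique h')

theorem mTerm_nonneg (n : ℕ) (s : List Bool) : 0 ≤ mTerm n s := by
  unfold mTerm
  positivity

theorem sum_mTerm_le (n : ℕ) (F : Finset (List Bool)) :
    ∑ s ∈ F, mTerm n s ≤ (1 / 2 : ℝ) ^ n := by
  have hsum : ∑ s ∈ F, (numOutput n false s + numOutput n true s) ≤
      2 * 2 ^ Nat.clog 2 ((4 * n + 2) ^ (2 * n)) := by
    rw [Finset.sum_add_distrib]
    have := Nat.le_pow_clog (b := 2) one_lt_two ((4 * n + 2) ^ (2 * n))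
    have := sum_numOutput_le n false F
    have := sum_numOutput_le n true F
    omega
  unfold mTerm
  rw [← Finset.sum_div, div_le_iff₀ (by positivity), ← Nat.cast_sum]
  calc _ ≤ ((2 * 2 ^ Nat.clog 2 ((4 * n + 2) ^ (2 * n)) : ℕ) : ℝ) := by exact_mod_cast hsum
    _ = (1 / 2 : ℝ) ^ n * 2 ^ expo n := by
      have h : (1 / 2 : ℝ) ^ n * 2 ^ n = 1 := by rw [← mul_pow]; norm_num
      rw [expo, pow_add, pow_succ]
      push_cast
      linear_combination (-2 * 2 ^ Nat.clog 2 ((4 * n + 2) ^ (2 * n))) * h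

theorem mTerm_le (n : ℕ) (s : List Bool) : mTerm n s ≤ (1 / 2 : ℝ) ^ n := by
  simpa using sum_mTerm_le n {s}

theorem summable_mTerm (s : List Bool) : Summable fun n => mTerm n s :=
  summable_geometric_two.of_nonneg_of_le (fun n => mTerm_nonneg n s) fun n => mTerm_le n s

theorem mDist_sub_mApprox (k : ℕ) (s : List Bool) :
    mDist s - mApprox k s = ∑' j : ℕ, mTerm (j + (k + 1)) s := by
  have h := ((summable_nat_add_iff 1).2 (summable_mTerm s)).sum_add_tsum_nat_add k
  have hk : mApprox k s = ∑ j ∈ Finset.range k, mTerm (j + 1) s := by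
    rw [mApprox, Finset.range_eq_Ico, Finset.sum_Ico_add' (fun n => mTerm n s)]
    rfl
  rw [mDist, hk, ← h, add_sub_cancel_left]
  simp only [add_assoc]

theorem hasSum_geometric_tail (k : ℕ) :
    HasSum (fun j : ℕ => (1 / 2 : ℝ) ^ (j + (k + 1))) (1 / 2 ^ k) := by
  have h := hasSum_geometric_two.mul_right ((1 / 2 : ℝ) ^ (k + 1))
  have hk : (2 : ℝ) * (1 / 2) ^ (k + 1) = 1 / 2 ^ k := by
    rw [pow_succ, one_div_pow]
    ring
  rw [hk] at h
  simpa only [← pow_add] using h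

theorem sum_abs_mDist_sub_mApprox_le (k : ℕ) (F : Finset (List Bool)) :
    ∑ s ∈ F, |mDist s - mApprox k s| ≤ 1 / 2 ^ k := by
  have htail (s : List Bool) : Summable fun j => mTerm (j + (k + 1)) s :=
    (summable_nat_add_iff (f := fun n => mTerm n s) (k + 1)).2 (summable_mTerm s)
  have habs (s : List Bool) : |mDist s - mApprox k s| = ∑' j : ℕ, mTerm (j + (k + 1)) s := by
    rw [mDist_sub_mApprox, abs_of_nonneg (tsum_nonneg fun j => mTerm_nonneg _ _)]
  calc ∑ s ∈ F, |mDist s - mApprox k s| = ∑ s ∈ F, ∑' j : ℕ, mTerm (j + (k + 1)) s :=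
        Finset.sum_congr rfl fun s _ => habs s
    _ = ∑' j : ℕ, ∑ s ∈ F, mTerm (j + (k + 1)) s :=
        (Summable.tsum_finsetSum fun s _ => htail s).symm
    _ ≤ ∑' j : ℕ, (1 / 2 : ℝ) ^ (j + (k + 1)) :=
        (summable_sum fun s _ => htail s).tsum_le_tsum (fun j => sum_mTerm_le (j + (k + 1)) F)
          (hasSum_geometric_tail k).summable
    _ = 1 / 2 ^ k := (hasSum_geometric_tail k).tsum_eq

/-- Convergence of `m_k` to `m`: for `k ≥ 1` the total error over all nonempty strings is
at most `1 / 2^k`. -/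
theorem mApprox_total_error_le (k : ℕ) (hk : 1 ≤ k) :
    ∑' s : {s : List Bool // s ≠ []}, |mDist s.val - mApprox k s.val| ≤ 1 / 2 ^ k := by
  refine Real.tsum_le_of_sum_le (fun s => abs_nonneg _) fun F => ?_
  simpa only [Finset.sum_map, Function.Embedding.subtype_apply] using
    sum_abs_mDist_sub_mApprox_le k (F.map (Function.Embedding.subtype _))
end

section
/- Computability of m_k: the function that takes a pair (k, s), where k ≥ 1 and s is a nonempty binary string, to the rational number m_k(s) is computable. -/
open Encodable

/-! ### Primitive recursion toolkit -/

theorem primrec_nat_pow : Primrec₂ ((· ^ ·) : ℕ → ℕ → ℕ) :=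
  Primrec₂.unpaired'.1 Nat.Primrec.pow

theorem Primrec.nat_count {α : Type*} [Primcodable α] {p : α → ℕ → Prop}
    [∀ a, DecidablePred (p a)] {g : α → ℕ} (hp : PrimrecRel p) (hg : Primrec g) :
    Primrec fun a => Nat.count (p a) (g a) := by
  have hstep : Primrec₂ fun (a : α) (x : ℕ × ℕ) => x.2 + if p a x.1 then 1 else 0 :=
    Primrec.nat_add.comp (Primrec.snd.comp Primrec.snd)
      (Primrec.ite (hp.comp Primrec.fst (Primrec.fst.comp Primrec.snd))
        (Primrec.const 1) (Primrec.const 0))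
  refine (Primrec.nat_rec' hg (Primrec.const 0) hstep).of_eq fun a => ?_
  induction g a with
  | zero => simp
  | succ k ih => rw [Nat.count_succ, ← ih]

theorem Nat.gcd_eq_findGreatest (a b : ℕ) :
    Nat.gcd a b = Nat.findGreatest (fun d => a % d = 0 ∧ b % d = 0) (a + b) := by
  symm
  rw [Nat.findGreatest_eq_iff]
  refine ⟨?_, fun _ => ⟨Nat.mod_eq_zero_of_dvd (Nat.gcd_dvd_left a b),
    Nat.mod_eq_zero_of_dvd (Nat.gcd_dvd_right a b)⟩, fun d hlt hle hd => ?_⟩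
  · rcases Nat.eq_zero_or_pos a with rfl | ha
    · simp
    · exact (Nat.gcd_le_left b ha).trans (Nat.le_add_right a b)
  · have hdvd := Nat.dvd_gcd (Nat.dvd_of_mod_eq_zero hd.1) (Nat.dvd_of_mod_eq_zero hd.2)
    have hpos : 0 < Nat.gcd a b := by
      rw [Nat.gcd_pos_iff]
      omega
    exact absurd (Nat.le_of_dvd hpos hdvd) (not_le.2 hlt)

theorem primrec_nat_gcd : Primrec₂ Nat.gcd := by
  have hrel : PrimrecRel fun (x : ℕ × ℕ) (d : ℕ) => x.1 % d = 0 ∧ x.2 % d = 0 :=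
    PrimrecPred.and
      (Primrec.eq.comp (Primrec.nat_mod.comp (Primrec.fst.comp Primrec.fst) Primrec.snd)
        (Primrec.const 0))
      (Primrec.eq.comp (Primrec.nat_mod.comp (Primrec.snd.comp Primrec.fst) Primrec.snd)
        (Primrec.const 0))
  exact (Primrec.nat_findGreatest (Primrec.nat_add.comp Primrec.fst Primrec.snd) hrel).of_eq
    fun x => (Nat.gcd_eq_findGreatest x.1 x.2).symm

theorem Nat.clog_eq_count (m : ℕ) : Nat.clog 2 m = Nat.count (fun j => 2 ^ j < m) m := by
  have hlt : ∀ j, 2 ^ j < m ↔ j < Nat.clog 2 m := fun j =>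
    (Nat.lt_clog_iff_pow_lt one_lt_two).symm
  have hle : Nat.clog 2 m ≤ m :=
    (Nat.clog_le_iff_le_pow one_lt_two).2 Nat.lt_two_pow_self.le
  rw [Nat.count_eq_card_filter_range]
  have : (Finset.range m).filter (fun j => 2 ^ j < m) = Finset.range (Nat.clog 2 m) := by
    ext j
    simp only [Finset.mem_filter, Finset.mem_range, hlt]
    omega
  rw [this, Finset.card_range]

theorem primrec_expo : Primrec expo := by
  have hclog : Primrec fun m : ℕ => Nat.clog 2 m := by
    refine (Primrec.nat_count (p := fun m j => 2 ^ j < m) ?_ Primrec.id).of_eq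
      fun m => (Nat.clog_eq_count m).symm
    exact Primrec.nat_lt.comp (primrec_nat_pow.comp (Primrec.const 2) Primrec.snd) Primrec.fst
  have hbase : Primrec fun n : ℕ => (4 * n + 2) ^ (2 * n) :=
    primrec_nat_pow.comp
      (Primrec.nat_add.comp (Primrec.nat_mul.comp (Primrec.const 4) Primrec.id) (Primrec.const 2))
      (Primrec.nat_mul.comp (Primrec.const 2) Primrec.id)
  exact Primrec.nat_add.comp Primrec.succ (hclog.comp hbase)

/-! ### Computability of rational quotients -/

theorem encode_ofEncodableOfInfinite {α : Type*} [E : Encodable α] [Infinite α]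
    [DecidablePred (· ∈ Set.range (@encode α E))] (x : α) :
    @encode α (Denumerable.ofEncodableOfInfinite α).toEncodable x =
      Nat.count (· ∈ Set.range (@encode α E)) (@encode α E x) := by
  trans (List.range (@encode α E x)).countP
    fun m => @decide (m ∈ Set.range (@encode α E)) (decidableRangeEncode α m)
  · rfl
  · unfold Nat.count
    congr!

theorem mem_range_encode_rat (m : ℕ) :
    m ∈ Set.range (@encode ℚ Rat.instEncodable) ↔
      0 < m.unpair.2 ∧ Nat.gcd ((m.unpair.1 + 1) / 2) m.unpair.2 = 1 := by
  have hcode : ∀ z : ℤ, (encode z + 1) / 2 = z.natAbs := by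
    rintro (n | n)
    · change (2 * n + 1) / 2 = n
      omega
    · change (2 * n + 1 + 1) / 2 = n + 1
      omega
  constructor
  · rintro ⟨q, rfl⟩
    change 0 < (Nat.pair (encode q.num) q.den).unpair.2 ∧
      Nat.gcd (((Nat.pair (encode q.num) q.den).unpair.1 + 1) / 2)
        (Nat.pair (encode q.num) q.den).unpair.2 = 1
    simp only [Nat.unpair_pair, hcode]
    exact ⟨q.den_pos, q.reduced⟩
  · rintro ⟨hpos, hgcd⟩
    obtain ⟨z, hz⟩ : ∃ z : ℤ, encode z = m.unpair.1 :=
      ⟨Denumerable.ofNat ℤ m.unpair.1, Denumerable.encode_ofNat _⟩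
    rw [← hz, hcode] at hgcd
    refine ⟨⟨z, m.unpair.2, hpos.ne', hgcd⟩, ?_⟩
    change Nat.pair (encode z) m.unpair.2 = m
    rw [hz, Nat.pair_unpair]

theorem encode_rat_natCast_div {a b : ℕ} (hb : 0 < b) :
    @encode ℚ Rat.instEncodable ((a : ℚ) / b) =
      Nat.pair (2 * (a / Nat.gcd a b)) (b / Nat.gcd a b) := by
  have hg : 0 < Nat.gcd a b := Nat.gcd_pos_of_pos_right a hb
  have hcop : Nat.Coprime (a / Nat.gcd a b) (b / Nat.gcd a b) := Nat.coprime_div_gcd_div_gcd hg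
  have hb' : 0 < b / Nat.gcd a b := Nat.div_pos (Nat.gcd_le_right a hb) hg
  have hq : (a : ℚ) / b = ((a / Nat.gcd a b : ℕ) : ℤ) / ((b / Nat.gcd a b : ℕ) : ℤ) := by
    have hgq : (Nat.gcd a b : ℚ) ≠ 0 := by exact_mod_cast hg.ne'
    rw [Int.cast_natCast, Int.cast_natCast, Nat.cast_div (Nat.gcd_dvd_left a b) hgq,
      Nat.cast_div (Nat.gcd_dvd_right a b) hgq, div_div_div_cancel_right₀ hgq]
  have hnum : ((a : ℚ) / b).num = ((a / Nat.gcd a b : ℕ) : ℤ) := by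
    rw [hq]
    exact Rat.num_div_eq_of_coprime (by exact_mod_cast hb') hcop
  have hden : (((a : ℚ) / b).den : ℤ) = ((b / Nat.gcd a b : ℕ) : ℤ) := by
    rw [hq]
    exact Rat.den_div_eq_of_coprime (by exact_mod_cast hb') hcop
  change Nat.pair (encode ((a : ℚ) / b).num) ((a : ℚ) / b).den = _
  rw [hnum, Nat.cast_injective hden]
  rfl

theorem Primrec.rat_natCast_div {α : Type*} [Primcodable α] {f g : α → ℕ} (hf : Primrec f)
    (hg : Primrec g) (hpos : ∀ a, 0 < g a) : Primrec fun a => (f a : ℚ) / g a := by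
  classical
  have hgcd := primrec_nat_gcd.comp hf hg
  have hcode : Primrec fun a => Nat.pair (2 * (f a / Nat.gcd (f a) (g a)))
      (g a / Nat.gcd (f a) (g a)) :=
    Primrec₂.natPair.comp
      (Primrec.nat_mul.comp (Primrec.const 2) (Primrec.nat_div.comp hf hgcd))
      (Primrec.nat_div.comp hg hgcd)
  have hfst : Primrec fun m : ℕ => m.unpair.1 := Primrec.fst.comp Primrec.unpair
  have hsnd : Primrec fun m : ℕ => m.unpair.2 := Primrec.snd.comp Primrec.unpair
  have hmem : PrimrecPred (· ∈ Set.range (@encode ℚ Rat.instEncodable)) := by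
    refine PrimrecPred.of_eq ?_ fun m => (mem_range_encode_rat m).symm
    exact PrimrecPred.and (Primrec.nat_lt.comp (Primrec.const 0) hsnd)
      (Primrec.eq.comp (primrec_nat_gcd.comp
        (Primrec.nat_div.comp (Primrec.succ.comp hfst) (Primrec.const 2)) hsnd)
        (Primrec.const 1))
  refine Primrec.encode_iff.1 ((Primrec.nat_count
    (p := fun (_ : α) m => m ∈ Set.range (@encode ℚ Rat.instEncodable))
    (hmem.comp Primrec.snd) hcode).of_eq fun a => ?_)
  rw [← encode_rat_natCast_div (hpos a)]
  exact (encode_ofEncodableOfInfinite (α := ℚ) _).symm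

/-! ### Two-stack simulation of machines coded as natural numbers -/

/-- State (`0` = halted, `q + 1` = state `q`), visited cells left of the head (nearest first),
scanned cell, visited cells right of the head. -/
abbrev SimConfig := ℕ × List Bool × Bool × List Bool

/-- The code of an instruction. -/
def instrCode {n : ℕ} : Instr n → ℕ
  | Sum.inl b => b.toNat
  | Sum.inr (q, b, d) => 2 + (4 * q + 2 * b.toNat + d.toNat)

/-- Execution of the instruction with a given code on blank symbol `i`. -/
def simExec (i : Bool) (d : ℕ) (c : SimConfig) : SimConfig :=
  if d < 2 then (0, c.2.1, decide (d % 2 = 1), c.2.2.2)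
  else if d % 2 = 1 then
    ((d - 2) / 4 + 1, decide ((d - 2) / 2 % 2 = 1) :: c.2.1, c.2.2.2.head?.getD i, c.2.2.2.tail)
  else
    ((d - 2) / 4 + 1, c.2.1.tail, c.2.1.head?.getD i, decide ((d - 2) / 2 % 2 = 1) :: c.2.2.2)

/-- One step of the machine whose table consists of the base-`N` digits of `m`. -/
def simStep (i : Bool) (N m : ℕ) (c : SimConfig) : SimConfig :=
  if c.1 = 0 then c
  else simExec i (m / N ^ (c.2.2.1.toNat + 2 * (c.1 - 1)) % N) c

/-- The word written on the visited cells. -/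
def simOutput (c : SimConfig) : List Bool := c.2.1.reverse ++ c.2.2.1 :: c.2.2.2

/-- The numeric code of a machine state. -/
def stateCode {n : ℕ} : Option (Fin n) → ℕ
  | none => 0
  | some q => q + 1

theorem stateCode_le {n : ℕ} (q : Option (Fin n)) : stateCode q ≤ n := by
  cases q with
  | none => exact Nat.zero_le n
  | some q => exact q.isLt

theorem stateCode_eq_zero_iff {n : ℕ} (q : Option (Fin n)) : stateCode q = 0 ↔ q = none := by
  cases q <;> simp [stateCode]

/-- A two-stack configuration represents a configuration on blank symbol `i`. -/
structure Represents {n : ℕ} (i : Bool) (c : Config n) (a : SimConfig) : Prop where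
  state : a.1 = stateCode c.state
  lo : c.lo = c.pos - a.2.1.length
  hi : c.hi = c.pos + a.2.2.2.length
  left : ∀ j : ℕ, c.tape (c.pos - 1 - j) = a.2.1[j]?.getD i
  cur : c.tape c.pos = a.2.2.1
  right : ∀ j : ℕ, c.tape (c.pos + 1 + j) = a.2.2.2[j]?.getD i

theorem Represents.init {n : ℕ} (hn : 0 < n) (i : Bool) :
    Represents i (initConfig n i) (1, [], i, []) := by
  constructor <;> simp [initConfig, hn, stateCode]

theorem Represents.step {n : ℕ} {i : Bool} {c : Config n} {a : SimConfig}
    (h : Represents i c a) {M : Machine n} {N m : ℕ}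
    (hm : ∀ (q : Fin n) (b : Bool), m / N ^ (b.toNat + 2 * q) % N = instrCode (M (q, b))) :
    Represents i (_root_.step M c) (simStep i N m a) := by
  obtain ⟨st, tape, pos, lo, hi⟩ := c
  obtain ⟨k, l, x, r⟩ := a
  obtain ⟨h1, h2, h3, h4, h5, h6⟩ := h
  simp only at h1 h2 h3 h4 h5 h6
  cases st with
  | none =>
    simp only [stateCode] at h1
    subst h1
    exact ⟨rfl, h2, h3, h4, h5, h6⟩
  | some q =>
    simp only [stateCode] at h1
    subst h1
    have hd := hm q x
    rcases hI : M (q, x) with b | ⟨q', b, d⟩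
    · have hs : _root_.step M ⟨some q, tape, pos, lo, hi⟩ =
          ⟨none, Function.update tape pos b, pos, lo, hi⟩ := by
        simp only [_root_.step, h5, hI]
      have ha : simStep i N m (q + 1, l, x, r) = (0, l, b, r) := by
        simp only [simStep, Nat.add_sub_cancel, hd, hI, instrCode]
        cases b <;> simp [simExec]
      rw [hs, ha]
      refine ⟨rfl, h2, h3, fun j => ?_, by simp, fun j => ?_⟩
      · simp only
        rw [Function.update_of_ne (by omega), h4]
      · simp only
        rw [Function.update_of_ne (by omega), h6]
    · have hdir : (4 * (q' : ℕ) + 2 * b.toNat + d.toNat) / 4 = q' ∧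
          (decide ((4 * (q' : ℕ) + 2 * b.toNat + d.toNat) / 2 % 2 = 1)) = b ∧
          ((2 + (4 * (q' : ℕ) + 2 * b.toNat + d.toNat)) % 2 = 1 ↔ d = true) := by
        cases b <;> cases d <;> simp <;> omega
      have hge : ¬ 2 + (4 * (q' : ℕ) + 2 * b.toNat + d.toNat) < 2 := by omega
      cases d with
      | true =>
        have hs : _root_.step M ⟨some q, tape, pos, lo, hi⟩ =
            ⟨some q', Function.update tape pos b, pos + 1, min lo (pos + 1),
              max hi (pos + 1)⟩ := by
          simp only [_root_.step, h5, hI, if_true]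
        have ha : simStep i N m (q + 1, l, x, r) =
            ((q' : ℕ) + 1, b :: l, r.head?.getD i, r.tail) := by
          simp only [simStep, Nat.add_sub_cancel, hd, hI, instrCode, simExec, hge,
            Nat.add_sub_cancel_left, hdir]
          simp
        rw [hs, ha]
        refine ⟨rfl, ?_, ?_, fun j => ?_, ?_, fun j => ?_⟩
        · simp only [List.length_cons]
          push_cast
          omega
        · simp only [List.length_tail]
          omega
        · simp only
          cases j with
          | zero => simp
          | succ j =>
            rw [Function.update_of_ne (by push_cast; omega), List.getElem?_cons_succ, ← h4]
            congr 1
            push_cast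
            ring
        · simp only
          rw [Function.update_of_ne (by omega), List.head?_eq_getElem?, ← h6]
          simp
        · simp only
          rw [Function.update_of_ne (by omega), List.getElem?_tail, ← h6]
          congr 1
          push_cast
          ring
      | false =>
        have hs : _root_.step M ⟨some q, tape, pos, lo, hi⟩ =
            ⟨some q', Function.update tape pos b, pos + -1, min lo (pos + -1),
              max hi (pos + -1)⟩ := by
          simp only [_root_.step, h5, hI]
          rfl
        have ha : simStep i N m (q + 1, l, x, r) =
            ((q' : ℕ) + 1, l.tail, l.head?.getD i, b :: r) := by
          simp only [simStep, Nat.add_sub_cancel, hd, hI, instrCode, simExec, hge,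
            Nat.add_sub_cancel_left, hdir]
          simp
        rw [hs, ha]
        refine ⟨rfl, ?_, ?_, fun j => ?_, ?_, fun j => ?_⟩
        · simp only [List.length_tail]
          omega
        · simp only [List.length_cons]
          push_cast
          omega
        · simp only
          rw [Function.update_of_ne (by omega), List.getElem?_tail, ← h4]
          congr 1
          push_cast
          ring
        · simp only
          rw [Function.update_of_ne (by omega), List.head?_eq_getElem?, ← h4]
          congr 1
          simp
          ring
        · simp only
          cases j with
          | zero => simp
          | succ j =>
            rw [Function.update_of_ne (by push_cast; omega), List.getElem?_cons_succ, ← h6]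
            congr 1
            push_cast
            ring

theorem outputOf_eq_map {n : ℕ} (c : Config n) :
    outputOf c = (List.range (c.hi - c.lo + 1).toNat).map fun j : ℕ => c.tape (c.lo + j) := by
  simp only [outputOf, bind_pure_comp, List.map_eq_map, List.map_map]
  rfl

theorem Represents.outputOf_eq {n : ℕ} {i : Bool} {c : Config n} {a : SimConfig}
    (h : Represents i c a) : outputOf c = simOutput a := by
  obtain ⟨st, tape, pos, lo, hi⟩ := c
  obtain ⟨k, l, x, r⟩ := a
  obtain ⟨-, h2, h3, h4, h5, h6⟩ := h
  simp only at h2 h3 h4 h5 h6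
  subst h2 h3
  have hlen : (pos + r.length - (pos - l.length) + 1).toNat = l.length + (r.length + 1) := by
    omega
  simp only [outputOf_eq_map, simOutput, hlen]
  refine List.ext_getElem (by simp) fun j hj _ => ?_
  simp only [List.length_map, List.length_range] at hj
  simp only [List.getElem_map, List.getElem_range]
  rcases lt_trichotomy j l.length with hlt | rfl | hgt
  · rw [List.getElem_append_left (by simpa using hlt), List.getElem_reverse]
    have := h4 (l.length - 1 - j)
    rw [List.getElem?_eq_getElem (by omega), Option.getD_some] at this
    rw [← this]
    congr 1
    omega
  · rw [List.getElem_append_right (by simp)]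
    simp [h5]
  · obtain ⟨t, rfl⟩ : ∃ t, j = l.length + 1 + t := ⟨j - (l.length + 1), by omega⟩
    rw [List.getElem_append_right (by simp; omega)]
    have := h6 t
    rw [List.getElem?_eq_getElem (by omega), Option.getD_some] at this
    have hidx : l.length + 1 + t - l.reverse.length = t + 1 := by simp; omega
    simp only [hidx, List.getElem_cons_succ]
    rw [← this]
    congr 1
    push_cast
    ring

theorem length_simOutput_le_simStep (i : Bool) (N m : ℕ) (a : SimConfig) :
    (simOutput a).length ≤ (simOutput (simStep i N m a)).length := by
  unfold simStep simExec
  split_ifs <;> simp [simOutput] <;> omega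

/-! ### Bounding the halting time -/


theorem halts_within_card {X Y : Type*} [Fintype Y] {f : X → X} {H : X → Prop}
    (hfix : ∀ x, H x → f x = x) (x : X) {t : ℕ} (ht : H (f^[t] x)) (g : X → Y)
    (hg : ∀ j ≤ t, ∀ k ≤ t, g (f^[j] x) = g (f^[k] x) → f^[j] x = f^[k] x) :
    H (f^[Fintype.card Y] x) := by
  classical
  have hex : ∃ t, H (f^[t] x) := ⟨t, ht⟩
  have hle : Nat.find hex ≤ t := Nat.find_min' hex ht
  have hH := Nat.find_spec hex
  rcases le_or_gt (Nat.find hex) (Fintype.card Y) with hcard | hcard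
  · rw [← Nat.sub_add_cancel hcard, Function.iterate_add_apply,
      Function.iterate_fixed (hfix _ hH)]
    exact hH
  · exfalso
    obtain ⟨j, k, hjk, heq⟩ := Fintype.exists_ne_map_eq_of_card_lt
      (fun j : Fin (Fintype.card Y + 1) => g (f^[j] x)) (by simp)
    wlog hlt : j < k generalizing j k
    · exact this k j hjk.symm heq.symm (lt_of_le_of_ne (not_lt.1 hlt) hjk.symm)
    have hj : (j : ℕ) ≤ Fintype.card Y := Nat.le_of_lt_succ j.isLt
    have hk : (k : ℕ) ≤ Fintype.card Y := Nat.le_of_lt_succ k.isLt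
    have hjk' : (j : ℕ) < k := hlt
    have hcycle : f^[j] x = f^[k] x := hg j (by omega) k (by omega) heq
    refine Nat.find_min hex (m := Nat.find hex - k + j) (by omega) ?_
    rw [Function.iterate_add_apply, hcycle, ← Function.iterate_add_apply,
      Nat.sub_add_cancel (by omega)]
    exact hH

/-- A bound on the number of two-stack configurations with `n` states and stacks of
height at most `L`. -/
def simBound (n L : ℕ) : ℕ := (n + 1) * (3 ^ L * (2 * 3 ^ L))

theorem List.eq_of_getElem?_fin {α : Type*} {l l' : List α} {L : ℕ} (hl : l.length ≤ L)
    (hl' : l'.length ≤ L) (h : ∀ j : Fin L, l[(j : ℕ)]? = l'[(j : ℕ)]?) : l = l' := by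
  refine List.ext_getElem? fun j => ?_
  rcases lt_or_ge j L with hj | hj
  · exact h ⟨j, hj⟩
  · rw [List.getElem?_eq_none (hl.trans hj), List.getElem?_eq_none (hl'.trans hj)]

/-- The configuration of the simulation after `t` steps. -/
def simRun (i : Bool) (N m t : ℕ) : SimConfig := (simStep i N m)^[t] (1, [], i, [])

theorem simRun_succ (i : Bool) (N m t : ℕ) :
    simRun i N m (t + 1) = simStep i N m (simRun i N m t) :=
  Function.iterate_succ_apply' _ _ _

theorem represents_simRun {n : ℕ} (hn : 0 < n) (i : Bool) {M : Machine n} {N m : ℕ}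
    (hm : ∀ (q : Fin n) (b : Bool), m / N ^ (b.toNat + 2 * q) % N = instrCode (M (q, b)))
    (t : ℕ) : Represents i (cfgAt M i t) (simRun i N m t) := by
  induction t with
  | zero => exact Represents.init hn i
  | succ t ih =>
    rw [simRun_succ, cfgAt, Function.iterate_succ_apply']
    exact ih.step hm

theorem outputs_iff_simRun {n : ℕ} (hn : 0 < n) (i : Bool) {M : Machine n} {N m : ℕ}
    (hm : ∀ (q : Fin n) (b : Bool), m / N ^ (b.toNat + 2 * q) % N = instrCode (M (q, b)))
    (s : List Bool) :
    Outputs M i s ↔ (simRun i N m (simBound n s.length)).1 = 0 ∧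
      simOutput (simRun i N m (simBound n s.length)) = s := by
  have hrep := represents_simRun hn i hm
  have hhalt : ∀ t, Halted (cfgAt M i t) ↔ (simRun i N m t).1 = 0 := fun t => by
    rw [(hrep t).state, stateCode_eq_zero_iff, Halted]
  have hfix : ∀ a : SimConfig, a.1 = 0 → simStep i N m a = a := fun a ha => if_pos ha
  constructor
  · rintro ⟨t, hH, hs⟩
    rw [hhalt] at hH
    rw [(hrep t).outputOf_eq] at hs
    have hmono : Monotone fun t => (simOutput (simRun i N m t)).length :=
      monotone_nat_of_le_succ fun t => by
        simp only [simRun_succ]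
        exact length_simOutput_le_simStep i N m _
    have hlen : ∀ j ≤ t, (simRun i N m j).2.1.length ≤ s.length ∧
        (simRun i N m j).2.2.2.length ≤ s.length := fun j hj => by
      have := hmono hj
      simp only [hs] at this
      simp only [simOutput, List.length_append, List.length_reverse, List.length_cons] at this
      omega
    have hstate : ∀ j, (simRun i N m j).1 < n + 1 := fun j => by
      rw [(hrep j).state]
      exact Nat.lt_succ_of_le (stateCode_le _)
    let g : SimConfig → Fin (n + 1) × (Fin s.length → Option Bool) × Bool ×
        (Fin s.length → Option Bool) := fun a =>
      (Fin.ofNat (n + 1) a.1, fun j => a.2.1[(j : ℕ)]?, a.2.2.1, fun j => a.2.2.2[(j : ℕ)]?)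
    have hB : (simRun i N m (simBound n s.length)).1 = 0 := by
      have := halts_within_card hfix (1, [], i, []) hH g fun j hj k hk heq => by
        change g (simRun i N m j) = g (simRun i N m k) at heq
        change simRun i N m j = simRun i N m k
        simp only [g, Prod.mk.injEq] at heq
        obtain ⟨h1, h2, h3, h4⟩ := heq
        have h1' := congrArg Fin.val h1
        simp only [Fin.val_ofNat, Nat.mod_eq_of_lt (hstate _)] at h1'
        exact Prod.ext h1' (Prod.ext
          (List.eq_of_getElem?_fin (hlen j hj).1 (hlen k hk).1 (congrFun h2))
          (Prod.ext h3
            (List.eq_of_getElem?_fin (hlen j hj).2 (hlen k hk).2 (congrFun h4))))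
      simpa [simBound, simRun] using this
    refine ⟨hB, ?_⟩
    have hstable : ∀ u v, u ≤ v → (simRun i N m u).1 = 0 → simRun i N m v = simRun i N m u :=
      fun u v huv hu => by
        rw [← Nat.sub_add_cancel huv, simRun, Function.iterate_add_apply]
        exact Function.iterate_fixed (hfix _ hu) _
    rcases le_total t (simBound n s.length) with hle | hle
    · rw [hstable _ _ hle hH, hs]
    · rw [← hstable _ _ hle hB, hs]
  · rintro ⟨hH, hs⟩
    exact ⟨_, (hhalt _).2 hH, (hrep _).outputOf_eq.trans hs⟩

/-! ### Enumeration of machines -/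

theorem instrCode_lt {n : ℕ} (I : Instr n) : instrCode I < 4 * n + 2 := by
  rcases I with b | ⟨q, b, d⟩
  · cases b <;> simp [instrCode]
  · have := q.isLt
    cases b <;> cases d <;> simp [instrCode] <;> omega

theorem instrCode_injective {n : ℕ} : Function.Injective (instrCode (n := n)) := by
  rintro (b | ⟨q, b, d⟩) (b' | ⟨q', b', d'⟩) h
  · cases b <;> cases b' <;> simp_all [instrCode]
  · cases b <;> simp [instrCode] at h <;> omega
  · cases b' <;> simp [instrCode] at h; omega
  · simp only [instrCode] at h
    have hq : (q : ℕ) = q' ∧ b = b' ∧ d = d' := by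
      cases b <;> cases b' <;> cases d <;> cases d' <;> simp at h ⊢ <;> omega
    rw [Fin.ext hq.1, hq.2.1, hq.2.2]

/-- Instructions are numbered by their codes. -/
noncomputable def instrEquiv (n : ℕ) : Instr n ≃ Fin (4 * n + 2) :=
  Equiv.ofBijective (fun I => ⟨instrCode I, instrCode_lt I⟩) <| by
    rw [Fintype.bijective_iff_injective_and_card]
    refine ⟨fun I J h => instrCode_injective (congrArg Fin.val h), ?_⟩
    simp
    ring

/-- Machines are numbered by their tables, read in base `4 * n + 2`. -/
noncomputable def machineEquiv (n : ℕ) : Machine n ≃ Fin ((4 * n + 2) ^ (n * 2)) :=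
  (Equiv.arrowCongr ((Equiv.prodCongrRight fun _ => finTwoEquiv.symm).trans finProdFinEquiv)
    (instrEquiv n)).trans finFunctionFinEquiv

theorem machineEquiv_digit {n : ℕ} (M : Machine n) (q : Fin n) (b : Bool) :
    (machineEquiv n M : ℕ) / (4 * n + 2) ^ (b.toNat + 2 * (q : ℕ)) % (4 * n + 2) =
      instrCode (M (q, b)) := by
  have hsymm := congrFun (finFunctionFinEquiv.symm_apply_apply
    (Equiv.arrowCongr ((Equiv.prodCongrRight fun _ => finTwoEquiv.symm).trans finProdFinEquiv)
      (instrEquiv n) M)) (finProdFinEquiv (q, finTwoEquiv.symm b))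
  have hval := congrArg Fin.val hsymm
  have hidx : ((finProdFinEquiv (q, finTwoEquiv.symm b) : Fin (n * 2)) : ℕ) =
      b.toNat + 2 * q := by
    cases b <;> simp [finProdFinEquiv, finTwoEquiv]
  rw [finFunctionFinEquiv_symm_apply_val, hidx] at hval
  refine hval.trans ?_
  simp [Equiv.arrowCongr, instrEquiv]

theorem Nat.count_eq_card_subtype_fin (p : ℕ → Prop) [DecidablePred p] (N : ℕ) :
    Nat.count p N = Nat.card {k : Fin N // p k} := by
  have hcard : Nat.card {k // k < N ∧ p k} = Nat.count p N := by
    rw [Nat.count_eq_card_filter_range]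
    exact Nat.subtype_card _ fun k => by simp
  rw [← hcard]
  exact Nat.card_congr ⟨fun k => ⟨⟨k.1, k.2.1⟩, k.2.2⟩, fun k => ⟨k.1, k.1.isLt, k.2⟩,
    fun _ => rfl, fun _ => rfl⟩

theorem numOutput_eq_count {n : ℕ} (hn : 0 < n) (i : Bool) (s : List Bool) :
    numOutput n i s = Nat.count
      (fun m => (simRun i (4 * n + 2) m (simBound n s.length)).1 = 0 ∧
        simOutput (simRun i (4 * n + 2) m (simBound n s.length)) = s)
      ((4 * n + 2) ^ (n * 2)) := by
  rw [Nat.count_eq_card_subtype_fin, numOutput]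
  exact Nat.card_congr ((machineEquiv n).subtypeEquiv
    fun M => outputs_iff_simRun hn i (machineEquiv_digit M) s)

/-! ### Primitive recursiveness of the counts -/

theorem primrec_simExec :
    Primrec fun x : (Bool × ℕ) × SimConfig => simExec x.1.1 x.1.2 x.2 := by
  have hi : Primrec fun x : (Bool × ℕ) × SimConfig => x.1.1 := Primrec.fst.comp Primrec.fst
  have hd : Primrec fun x : (Bool × ℕ) × SimConfig => x.1.2 := Primrec.snd.comp Primrec.fst
  have hl : Primrec fun x : (Bool × ℕ) × SimConfig => x.2.2.1 :=
    Primrec.fst.comp (Primrec.snd.comp Primrec.snd)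
  have hr : Primrec fun x : (Bool × ℕ) × SimConfig => x.2.2.2.2 :=
    Primrec.snd.comp (Primrec.snd.comp (Primrec.snd.comp Primrec.snd))
  have hodd : ∀ {f : (Bool × ℕ) × SimConfig → ℕ}, Primrec f →
      PrimrecPred fun x => f x % 2 = 1 := fun hf =>
    Primrec.eq.comp (Primrec.nat_mod.comp hf (Primrec.const 2)) (Primrec.const 1)
  have hd2 := Primrec.nat_sub.comp hd (Primrec.const 2)
  have hq := Primrec.succ.comp (Primrec.nat_div.comp hd2 (Primrec.const 4))
  have hb := (hodd (Primrec.nat_div.comp hd2 (Primrec.const 2))).decide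
  exact Primrec.ite (Primrec.nat_lt.comp hd (Primrec.const 2))
    ((Primrec.const 0).pair (hl.pair ((hodd hd).decide.pair hr)))
    (Primrec.ite (hodd hd)
      (hq.pair ((Primrec.list_cons.comp hb hl).pair
        ((Primrec.option_getD.comp (Primrec.list_head?.comp hr) hi).pair
          (Primrec.list_tail.comp hr))))
      (hq.pair ((Primrec.list_tail.comp hl).pair
        ((Primrec.option_getD.comp (Primrec.list_head?.comp hl) hi).pair
          (Primrec.list_cons.comp hb hr)))))

theorem primrec_simStep :
    Primrec₂ fun (p : Bool × ℕ × ℕ) (c : SimConfig) => simStep p.1 p.2.1 p.2.2 c := by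
  have hi : Primrec fun x : (Bool × ℕ × ℕ) × SimConfig => x.1.1 := Primrec.fst.comp Primrec.fst
  have hN : Primrec fun x : (Bool × ℕ × ℕ) × SimConfig => x.1.2.1 :=
    Primrec.fst.comp (Primrec.snd.comp Primrec.fst)
  have hm : Primrec fun x : (Bool × ℕ × ℕ) × SimConfig => x.1.2.2 :=
    Primrec.snd.comp (Primrec.snd.comp Primrec.fst)
  have hc : Primrec fun x : (Bool × ℕ × ℕ) × SimConfig => x.2 := Primrec.snd
  have hb : Primrec fun x : (Bool × ℕ × ℕ) × SimConfig => x.2.2.2.1.toNat :=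
    (Primrec.dom_bool Bool.toNat).comp
      (Primrec.fst.comp (Primrec.snd.comp (Primrec.snd.comp hc)))
  have hq := Primrec.fst.comp hc
  have hdigit := Primrec.nat_mod.comp (Primrec.nat_div.comp hm (primrec_nat_pow.comp hN
    (Primrec.nat_add.comp hb (Primrec.nat_mul.comp (Primrec.const 2)
      (Primrec.nat_sub.comp hq (Primrec.const 1)))))) hN
  exact Primrec.ite (Primrec.eq.comp hq (Primrec.const 0)) hc
    (primrec_simExec.comp ((hi.pair hdigit).pair hc))

theorem primrec_simBound : Primrec₂ simBound := by
  have hpow : Primrec fun x : ℕ × ℕ => 3 ^ x.2 :=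
    primrec_nat_pow.comp (Primrec.const 3) Primrec.snd
  exact Primrec.nat_mul.comp (Primrec.succ.comp Primrec.fst)
    (Primrec.nat_mul.comp hpow (Primrec.nat_mul.comp (Primrec.const 2) hpow))

theorem primrec_simOutput : Primrec simOutput :=
  Primrec.list_append.comp (Primrec.list_reverse.comp (Primrec.fst.comp Primrec.snd))
    (Primrec.list_cons.comp (Primrec.fst.comp (Primrec.snd.comp Primrec.snd))
      (Primrec.snd.comp (Primrec.snd.comp Primrec.snd)))

/-- `numOutput` as computed by the simulation. -/
def simCount (n : ℕ) (i : Bool) (s : List Bool) : ℕ :=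
  Nat.count
    (fun m => (simRun i (4 * n + 2) m (simBound n s.length)).1 = 0 ∧
      simOutput (simRun i (4 * n + 2) m (simBound n s.length)) = s)
    ((4 * n + 2) ^ (n * 2))

theorem primrec_simCount (i : Bool) : Primrec₂ fun n s => simCount n i s := by
  have hbase : ∀ {α : Type} [Primcodable α] {f : α → ℕ}, Primrec f →
      Primrec fun x => 4 * f x + 2 := fun hf =>
    Primrec.nat_add.comp (Primrec.nat_mul.comp (Primrec.const 4) hf) (Primrec.const 2)
  have hn : Primrec fun x : (ℕ × List Bool) × ℕ => x.1.1 := Primrec.fst.comp Primrec.fst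
  have hs : Primrec fun x : (ℕ × List Bool) × ℕ => x.1.2 := Primrec.snd.comp Primrec.fst
  have hrun : Primrec fun x : (ℕ × List Bool) × ℕ =>
      simRun i (4 * x.1.1 + 2) x.2 (simBound x.1.1 x.1.2.length) :=
    Primrec.nat_iterate (h := fun (x : (ℕ × List Bool) × ℕ) c => simStep i (4 * x.1.1 + 2) x.2 c)
      (primrec_simBound.comp hn (Primrec.list_length.comp hs)) (Primrec.const (1, [], i, []))
      (primrec_simStep.comp
        (Primrec.pair (Primrec.const i) (((hbase hn).pair Primrec.snd).comp Primrec.fst))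
        Primrec.snd)
  refine Primrec.nat_count (α := ℕ × List Bool)
    (p := fun x m => (simRun i (4 * x.1 + 2) m (simBound x.1 x.2.length)).1 = 0 ∧
      simOutput (simRun i (4 * x.1 + 2) m (simBound x.1 x.2.length)) = x.2) ?_
    (primrec_nat_pow.comp (hbase Primrec.fst)
      (Primrec.nat_mul.comp Primrec.fst (Primrec.const 2)))
  exact PrimrecPred.and (Primrec.eq.comp (Primrec.fst.comp hrun) (Primrec.const 0))
    (Primrec.eq.comp (primrec_simOutput.comp hrun) hs)

/-- Numerator and denominator of the partial sums of `simCount` weighted by `2 ^ expo`. -/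
def partialFraction (s : List Bool) : ℕ → ℕ × ℕ
  | 0 => (0, 1)
  | k + 1 =>
    ((partialFraction s k).1 * 2 ^ expo (k + 1) +
      (simCount (k + 1) false s + simCount (k + 1) true s) * (partialFraction s k).2,
     (partialFraction s k).2 * 2 ^ expo (k + 1))

theorem partialFraction_snd_pos (s : List Bool) (k : ℕ) : 0 < (partialFraction s k).2 := by
  induction k with
  | zero => exact one_pos
  | succ k ih => exact Nat.mul_pos ih (by positivity)

theorem partialFraction_div (s : List Bool) (k : ℕ) :
    ((partialFraction s k).1 : ℚ) / (partialFraction s k).2 = mApproxQ k s := by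
  induction k with
  | zero => simp [partialFraction, mApproxQ]
  | succ k ih =>
    have hsum : mApproxQ (k + 1) s = mApproxQ k s +
        ((numOutput (k + 1) false s + numOutput (k + 1) true s : ℕ) : ℚ) / 2 ^ expo (k + 1) :=
      Finset.sum_Icc_succ_top (by omega) _
    have hcount : ∀ i, numOutput (k + 1) i s = simCount (k + 1) i s := fun i =>
      numOutput_eq_count k.succ_pos i s
    have hpos : ((partialFraction s k).2 : ℚ) ≠ 0 := by
      exact_mod_cast (partialFraction_snd_pos s k).ne'
    rw [hsum, ← ih, hcount, hcount]
    simp only [partialFraction]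
    push_cast
    field_simp

theorem primrec_partialFraction :
    Primrec fun x : ℕ × List Bool => partialFraction x.2 x.1 := by
  have hk : Primrec fun y : (ℕ × List Bool) × ℕ × ℕ × ℕ => y.2.1 + 1 :=
    Primrec.succ.comp (Primrec.fst.comp Primrec.snd)
  have hs : Primrec fun y : (ℕ × List Bool) × ℕ × ℕ × ℕ => y.1.2 :=
    Primrec.snd.comp Primrec.fst
  have ha : Primrec fun y : (ℕ × List Bool) × ℕ × ℕ × ℕ => y.2.2.1 :=
    Primrec.fst.comp (Primrec.snd.comp Primrec.snd)
  have hb : Primrec fun y : (ℕ × List Bool) × ℕ × ℕ × ℕ => y.2.2.2 :=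
    Primrec.snd.comp (Primrec.snd.comp Primrec.snd)
  have hpow := primrec_nat_pow.comp (Primrec.const 2) (primrec_expo.comp hk)
  have hstep : Primrec₂ fun (x : ℕ × List Bool) (y : ℕ × ℕ × ℕ) =>
      (y.2.1 * 2 ^ expo (y.1 + 1) +
        (simCount (y.1 + 1) false x.2 + simCount (y.1 + 1) true x.2) * y.2.2,
       y.2.2 * 2 ^ expo (y.1 + 1)) :=
    (Primrec.nat_add.comp (Primrec.nat_mul.comp ha hpow)
      (Primrec.nat_mul.comp (Primrec.nat_add.comp ((primrec_simCount false).comp hk hs)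
        ((primrec_simCount true).comp hk hs)) hb)).pair (Primrec.nat_mul.comp hb hpow)
  refine (Primrec.nat_rec' Primrec.fst (Primrec.const (0, 1)) hstep).of_eq fun x => ?_
  obtain ⟨k, s⟩ := x
  induction k with
  | zero => rfl
  | succ k ih =>
    simp only [partialFraction] at ih ⊢
    rw [← ih]

/-- Computability of `m_k`: the function taking `(k, s)` with `k ≥ 1` and `s` nonempty to
the rational number `m_k(s)` is computable. -/
theorem mApproxQ_computable :
    ∃ f : ℕ × List Bool → ℚ, Computable f ∧
      ∀ k, 1 ≤ k → ∀ s : List Bool, s ≠ [] → f (k, s) = mApproxQ k s :=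
  ⟨_, (Primrec.rat_natCast_div (Primrec.fst.comp primrec_partialFraction)
      (Primrec.snd.comp primrec_partialFraction)
      fun x => partialFraction_snd_pos x.2 x.1).to_comp,
    fun k _ s _ => partialFraction_div s k⟩
end

section
/- Non-computability of the longest output: the function l that maps k ≥ 1 to the length of the longest nonempty binary string s with m_k(s) > 0 (i.e., the maximum output length over all halting runs, on either blank symbol, of machines with at most k states) is not computable. -/
/-- The length of the longest nonempty string `s` with `m_k(s) > 0`. -/
noncomputable def longestLen (k : ℕ) : ℕ :=
  sSup {L | ∃ s : List Bool, s ≠ [] ∧ 0 < mApprox k s ∧ s.length = L}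

/-- A machine whose output is nonempty is counted in `longestLen`. -/
theorem length_le_longestLen {n k : ℕ} (hn : 1 ≤ n) (hnk : n ≤ k) {τ : Machine n} {i : Bool}
    {s : List Bool} (hs : s ≠ []) (h : Outputs τ i s) : s.length ≤ longestLen k := by
  have hunique : ∀ {n : ℕ} (τ : Machine n) (i : Bool) (s₁ s₂ : List Bool),
      Outputs τ i s₁ → Outputs τ i s₂ → s₁ = s₂ := by
    rintro n τ i _ _ ⟨t₁, h₁, rfl⟩ ⟨t₂, h₂, rfl⟩
    have key : ∀ t d : ℕ, Halted (cfgAt τ i t) → cfgAt τ i (t + d) = cfgAt τ i t := by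
      intro t d ht
      induction d with
      | zero => rfl
      | succ d ih =>
        rw [← add_assoc, cfgAt, Function.iterate_succ_apply', ← cfgAt, ih, step, ht]
    rcases le_total t₁ t₂ with h | h
    · obtain ⟨d, rfl⟩ := Nat.exists_eq_add_of_le h
      rw [key _ _ h₁]
    · obtain ⟨d, rfl⟩ := Nat.exists_eq_add_of_le h
      rw [key _ _ h₂]
  refine le_csSup ?_ ⟨s, hs, ?_, rfl⟩
  · suffices hfin : (⋃ n ∈ Finset.Icc 1 k, ⋃ τ : Machine n, ⋃ i : Bool,
        {L | ∃ s, Outputs τ i s ∧ s.length = L}).Finite by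
      refine (hfin.subset ?_).bddAbove
      rintro L ⟨s, -, hpos, rfl⟩
      obtain ⟨n, hn, hne⟩ := Finset.exists_ne_zero_of_sum_ne_zero hpos.ne'
      have hne' : numOutput n false s ≠ 0 ∨ numOutput n true s ≠ 0 := by
        by_contra! hz
        exact hne (by simp [mTerm, hz.1, hz.2])
      have : ∃ (τ : Machine n) (i : Bool), Outputs τ i s := by
        rcases hne' with h | h
        all_goals
          obtain ⟨⟨τ, hτ⟩⟩ := (Nat.card_ne_zero.1 h).1
          exact ⟨τ, _, hτ⟩
      obtain ⟨τ, i, hτ⟩ := this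
      simp only [Set.mem_iUnion]
      exact ⟨n, hn, τ, i, s, hτ, rfl⟩
    refine Set.Finite.biUnion (Finset.finite_toSet _) fun n _ ↦ Set.finite_iUnion fun τ ↦
      Set.finite_iUnion fun i ↦ Set.Subsingleton.finite ?_
    rintro _ ⟨s₁, h₁, rfl⟩ _ ⟨s₂, h₂, rfl⟩
    rw [hunique τ i s₁ s₂ h₁ h₂]
  · refine Finset.sum_pos' (fun n _ ↦ by unfold mTerm; positivity)
      ⟨n, Finset.mem_Icc.2 ⟨hn, hnk⟩, ?_⟩
    have hcard : 0 < numOutput n i s := by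
      have : Nonempty {τ : Machine n // Outputs τ i s} := ⟨⟨τ, h⟩⟩
      exact Nat.card_pos
    have : 0 < numOutput n false s + numOutput n true s := by
      cases i <;> omega
    unfold mTerm
    positivity

namespace Config

/-- The head lies in the visited interval, and every nonblank cell has been visited. -/
structure Visited {n : ℕ} (c : Config n) : Prop where
  lo_le_pos : c.lo ≤ c.pos
  pos_le_hi : c.pos ≤ c.hi
  lo_le : ∀ x, c.tape x = true → c.lo ≤ x
  le_hi : ∀ x, c.tape x = true → x ≤ c.hi

theorem visited_initConfig (n : ℕ) : (initConfig n false).Visited := by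
  constructor <;> simp [initConfig]

theorem Visited.step {n : ℕ} (M : Machine n) {c : Config n} (h : c.Visited) :
    (step M c).Visited := by
  obtain ⟨h₁, h₂, h₃, h₄⟩ := h
  unfold _root_.step
  split
  · exact ⟨h₁, h₂, h₃, h₄⟩
  · split
    · refine ⟨h₁, h₂, fun x hx ↦ ?_, fun x hx ↦ ?_⟩ <;>
      · by_cases e : x = c.pos
        · subst e; assumption
        · simp only [Function.update_of_ne e] at hx
          solve_by_elim
    · refine ⟨min_le_right _ _, le_max_right _ _, fun x hx ↦ ?_, fun x hx ↦ ?_⟩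
      · refine min_le_of_left_le ?_
        by_cases e : x = c.pos
        · subst e; assumption
        · simp only [Function.update_of_ne e] at hx
          exact h₃ _ hx
      · refine le_max_of_le_left ?_
        by_cases e : x = c.pos
        · subst e; assumption
        · simp only [Function.update_of_ne e] at hx
          exact h₄ _ hx

theorem visited_cfgAt {n : ℕ} (M : Machine n) (t : ℕ) : (cfgAt M false t).Visited := by
  induction t with
  | zero => exact visited_initConfig n
  | succ t ih =>
    rw [cfgAt, Function.iterate_succ_apply']
    exact ih.step M

end Config

namespace Turing

/-- The configuration `c` is in state `q` and its tape, seen from the head, is `T`. -/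
def Shows {n : ℕ} (q : Option (Fin n)) (T : Tape Bool) (c : Config n) : Prop :=
  c.state = q ∧ ∀ i, c.tape (c.pos + i) = T.nth i

theorem Shows.head {n : ℕ} {q : Option (Fin n)} {T : Tape Bool} {c : Config n}
    (h : Shows q T c) : c.tape c.pos = T.head := by
  simpa using h.2 0

theorem Shows.update {n : ℕ} {q : Option (Fin n)} {T : Tape Bool} {c : Config n}
    (h : Shows q T c) (b : Bool) (i : ℤ) :
    Function.update c.tape c.pos b (c.pos + i) = (T.write b).nth i := by
  rw [Tape.write_nth, ← h.2, Function.update_apply]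
  simp

theorem Shows.step_halt {n : ℕ} {M : Machine n} {q : Fin n} {T : Tape Bool} {c : Config n}
    (h : Shows (some q) T c) {b : Bool} (hM : M (q, T.head) = Sum.inl b) :
    Shows none (T.write b) (step M c) := by
  have hu := h.update b
  simp only [step, h.1, h.head, hM]
  exact ⟨rfl, hu⟩

/-- The direction in which an instruction of a `Machine` moves the head. -/
def dirOf (d : Bool) : Dir := if d then Dir.right else Dir.left

theorem Shows.step_move {n : ℕ} {M : Machine n} {q q' : Fin n} {T : Tape Bool} {c : Config n}
    (h : Shows (some q) T c) {b d : Bool} (hM : M (q, T.head) = Sum.inr (q', b, d)) :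
    Shows (some q') ((T.write b).move (dirOf d)) (step M c) := by
  have hu := h.update b
  simp only [step, h.1, h.head, hM]
  refine ⟨rfl, fun i ↦ ?_⟩
  cases d
  · simp only [dirOf, Bool.false_eq_true, if_false, Tape.move_left_nth, ← hu]
    congr 1; ring
  · simp only [dirOf, if_true, Tape.move_right_nth, ← hu]
    congr 1; ring

/-- Finitely many steps of `M` lead from `c` to a configuration showing `q` and `T`. -/
def Leads {n : ℕ} (M : Machine n) (c : Config n) (q : Option (Fin n)) (T : Tape Bool) : Prop :=
  ∃ t, Shows q T ((step M)^[t] c)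

theorem Leads.halt {n : ℕ} {M : Machine n} {q : Fin n} {T : Tape Bool} {c : Config n}
    (h : Leads M c (some q) T) (hM : M (q, T.head) = Sum.inl T.head) :
    Leads M c none T := by
  obtain ⟨t, ht⟩ := h
  refine ⟨t + 1, ?_⟩
  rw [Function.iterate_succ_apply']
  simpa using ht.step_halt hM

theorem Leads.move {n : ℕ} {M : Machine n} {q q' : Fin n} {T T' : Tape Bool} {c : Config n}
    (h : Leads M c (some q) T) {b d : Bool} (hM : M (q, T.head) = Sum.inr (q', b, d))
    (hT : (T.write b).move (dirOf d) = T') :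
    Leads M c (some q') T' := by
  obtain ⟨t, ht⟩ := h
  refine ⟨t + 1, ?_⟩
  rw [Function.iterate_succ_apply', ← hT]
  exact ht.step_move hM

section Simulation

variable {Q : Type} [Inhabited Q] (M : TM0.Machine Bool Q) (l : List Bool)

/-- The transitions of a Busy Beaver machine which first writes `l` on a blank tape, from right to
left, and then simulates `M`.  A writing step of `M` moves right, and is followed by a step in a
state `(q, false)` which moves back left. -/
def simStep : Fin (l.length + 1) ⊕ Q × Bool → Bool →
    Bool ⊕ (Fin (l.length + 1) ⊕ Q × Bool) × Bool × Bool
  | Sum.inl i, _ =>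
    if h : i.1 < l.length then
      Sum.inr (Sum.inl ⟨i.1 + 1, Nat.succ_lt_succ h⟩, l.reverse[i.1]'(by simpa using h), false)
    else Sum.inr (Sum.inr (default, true), false, true)
  | Sum.inr (q, false), a => Sum.inr (Sum.inr (q, true), a, false)
  | Sum.inr (q, true), a =>
    match M q a with
    | none => Sum.inl a
    | some (q', TM0.Stmt.move Dir.left) => Sum.inr (Sum.inr (q', true), a, false)
    | some (q', TM0.Stmt.move Dir.right) => Sum.inr (Sum.inr (q', true), a, true)
    | some (q', TM0.Stmt.write b) => Sum.inr (Sum.inr (q', false), b, true)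

/-- The Busy Beaver machine with the transitions `simStep`, for an enumeration `e` of its states. -/
def simMachine {n : ℕ} (e : Fin (l.length + 1) ⊕ Q × Bool ≃ Fin n) : Machine n :=
  fun p ↦ (simStep M l (e.symm p.1) p.2).map id (Prod.map e id)

variable {M l} {n : ℕ} {e : Fin (l.length + 1) ⊕ Q × Bool ≃ Fin n}

theorem leads_prefix (h0 : (initConfig n false).state = some (e (Sum.inl 0))) (i : ℕ)
    (hi : i < l.length + 1) :
    Leads (simMachine M l e) (initConfig n false) (some (e (Sum.inl ⟨i, hi⟩)))
      (Tape.mk' ∅ (ListBlank.cons false (ListBlank.mk (l.reverse.take i).reverse))) := by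
  induction i with
  | zero =>
    refine ⟨0, h0, fun i ↦ ?_⟩
    have : Tape.mk' ∅ (ListBlank.cons false (ListBlank.mk (l.reverse.take 0).reverse)) =
        (default : Tape Bool) := rfl
    rw [this]
    rcases i with (_ | i) | i <;> rfl
  | succ i ih =>
    have hl : i < l.length := by omega
    refine (ih (by omega)).move (b := l.reverse[i]'(by simpa using hl)) (d := false) ?_ ?_
    · simp [simMachine, simStep, hl]
    · rw [List.take_succ_eq_append_getElem (by simpa using hl)]
      simp [dirOf]
      rfl

theorem leads_simulation (h0 : (initConfig n false).state = some (e (Sum.inl 0))) :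
    Leads (simMachine M l e) (initConfig n false) (some (e (Sum.inr (default, true))))
      (Tape.mk₁ l) := by
  refine (leads_prefix h0 l.length (Nat.lt_succ_self _)).move (b := false) (d := true) ?_ ?_
  · simp [simMachine, simStep]
  · rw [List.take_of_length_le (by simp), List.reverse_reverse]
    have : (ListBlank.cons default ∅ : ListBlank Bool) = ∅ :=
      ListBlank.cons_head_tail (∅ : ListBlank Bool)
    simp only [dirOf, if_true, Tape.write_mk', Tape.move_right_mk', ListBlank.head_cons,
      ListBlank.tail_cons, Tape.mk₁, Tape.mk₂]
    exact congrArg (Tape.mk' · (ListBlank.mk l)) this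

theorem Leads.simulate {c : Config n} {a b : TM0.Cfg Bool Q}
    (h : Leads (simMachine M l e) c (some (e (Sum.inr (a.q, true)))) a.Tape)
    (hab : StateTransition.Reaches (TM0.step M) a b) :
    Leads (simMachine M l e) c (some (e (Sum.inr (b.q, true)))) b.Tape := by
  induction hab with
  | refl => exact h
  | @tail a b _ hab ih =>
    obtain ⟨q, T⟩ := a
    obtain ⟨⟨q', s⟩, hM, rfl⟩ := Option.map_eq_some_iff.1 hab
    rcases s with (_ | _) | x
    · exact ih.move (b := T.head) (d := false) (by simp [simMachine, simStep, hM])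
        (by simp [dirOf])
    · exact ih.move (b := T.head) (d := true) (by simp [simMachine, simStep, hM])
        (by simp [dirOf])
    · refine (ih.move (b := x) (d := true) (q' := e (Sum.inr (q', false)))
        (by simp [simMachine, simStep, hM]) rfl).move (b := ((T.write x).move Dir.right).head)
          (d := false) (by simp [simMachine, simStep, dirOf]) ?_
      simp [dirOf]

end Simulation

/-- A finite `TM0` machine over `Bool` started on the word `l` is simulated by a Busy Beaver machine
started on a blank tape, with a number of states that only exceeds `l.length` by a constant. -/
theorem exists_outputs_of_mem_eval {Q : Type} [Inhabited Q] [Finite Q] (M : TM0.Machine Bool Q)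
    (l : List Bool) {c : TM0.Cfg Bool Q}
    (hc : c ∈ StateTransition.eval (TM0.step M) (TM0.init l)) {j : ℕ}
    (hj : c.Tape.nth j = true) :
    ∃ (τ : Machine (l.length + 1 + Nat.card (Q × Bool))) (s : List Bool),
      Outputs τ false s ∧ j < s.length := by
  obtain ⟨hreach, hhalt⟩ := StateTransition.mem_eval.1 hc
  let e : Fin (l.length + 1) ⊕ Q × Bool ≃ Fin (l.length + 1 + Nat.card (Q × Bool)) :=
    (Equiv.sumCongr (Equiv.refl _) (Finite.equivFin _)).trans finSumFinEquiv
  have h0 : (initConfig _ false).state = some (e (Sum.inl 0)) := by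
    simp [initConfig, e, Fin.ext_iff]
  have hM : M c.q c.Tape.head = none := by
    simpa [TM0.step] using hhalt
  obtain ⟨t, hstate, htape⟩ := (Leads.simulate (leads_simulation (M := M) h0) hreach).halt
    (by simp [simMachine, simStep, hM])
  refine ⟨simMachine M l e, _, ⟨t, hstate, rfl⟩, ?_⟩
  have hv := Config.visited_cfgAt (simMachine M l e) t
  have hle := hv.le_hi _ ((htape j).trans hj)
  have hlo := hv.lo_le_pos
  unfold outputOf
  have hlen : ∀ m : ℕ, (do let a ← List.range m; pure (a : ℤ)).length = m := by simp
  rw [List.length_map, hlen]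
  unfold cfgAt at *
  omega

end Turing

namespace Turing

theorem ListBlank.nth_append_length_add {Γ : Type*} [Inhabited Γ] (l : List Γ) (L : ListBlank Γ)
    (j : ℕ) : (ListBlank.append l L).nth (l.length + j) = L.nth j := by
  induction l with
  | nil => simp [ListBlank.append]
  | cons a l ih =>
    rw [List.length_cons, Nat.add_right_comm, ListBlank.nth_succ]
    simpa [ListBlank.append] using ih

theorem ListBlank.nth_append_of_lt {Γ : Type*} [Inhabited Γ] (l : List Γ) (L : ListBlank Γ)
    (j : ℕ) (hj : j < l.length) : (ListBlank.append l L).nth j = l[j] := by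
  induction l generalizing j with
  | nil => simp at hj
  | cons a l ih =>
    cases j with
    | zero => simp [ListBlank.append]
    | succ j =>
      rw [ListBlank.nth_succ]
      simpa [ListBlank.append] using ih j (by simpa using hj)

/-- A nonblank cell at position `i` is encoded by a block with a nonblank cell at a position at
least `i`. -/
theorem ListBlank.exists_nth_flatMap {Γ : Type*} [Inhabited Γ] {n : ℕ} {f : Γ → List Bool}
    (hlen : ∀ a, (f a).length = n) (hf : ∃ n, f default = List.replicate n default)
    (htrue : ∀ a, a ≠ default → true ∈ f a) {i : ℕ} {L : ListBlank Γ} (h : L.nth i ≠ default) :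
    ∃ j, i ≤ j ∧ (L.flatMap f hf).nth j = true := by
  have hn : 0 < n := hlen (L.nth i) ▸ List.length_pos_of_mem (htrue _ h)
  induction i generalizing L with
  | zero =>
    obtain ⟨a, L, rfl⟩ := L.exists_cons
    obtain ⟨j, hj, hj'⟩ := List.getElem_of_mem (htrue a (by simpa using h))
    refine ⟨j, Nat.zero_le _, ?_⟩
    rw [ListBlank.cons_flatMap, ListBlank.nth_append_of_lt _ _ _ hj, hj']
  | succ i ih =>
    obtain ⟨a, L, rfl⟩ := L.exists_cons
    obtain ⟨j, hij, hj⟩ := ih (L := L) (by simpa [ListBlank.nth_succ] using h)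
    refine ⟨(f a).length + j, by rw [hlen]; omega, ?_⟩
    rw [ListBlank.cons_flatMap, ListBlank.nth_append_length_add, hj]

/-- A `TM0` machine supported on a finite set of states is simulated by a machine with a finite type
of states. -/
theorem TM0.exists_finite_machine {Γ Λ : Type} [Inhabited Γ] [Inhabited Λ] (M : TM0.Machine Γ Λ)
    {S : Set Λ} (hS : S.Finite) (ss : TM0.Supports M S) :
    ∃ (Q : Type) (_ : Inhabited Q) (_ : Finite Q) (M' : TM0.Machine Γ Q),
      ∀ l c, c ∈ StateTransition.eval (TM0.step M) (TM0.init l) →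
        ∃ q, (⟨q, c.Tape⟩ : TM0.Cfg Γ Q) ∈ StateTransition.eval (TM0.step M') (TM0.init l) := by
  classical
  let : Inhabited S := ⟨⟨default, ss.1⟩⟩
  let idm : PointedMap Γ Γ := ⟨id, rfl⟩
  let g : Λ → S := fun q ↦ if h : q ∈ S then ⟨q, h⟩ else default
  have hmap : ∀ T : Tape Γ, T.map idm = T := by
    intro T
    obtain ⟨L, R, rfl⟩ := T.exists_mk'
    rw [Tape.map_mk']
    congr 1 <;> exact ListBlank.ext fun i ↦ ListBlank.nth_map _ _ _
  refine ⟨S, inferInstance, hS, M.map idm idm g Subtype.val, fun l c hc ↦ ?_⟩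
  obtain ⟨d, ⟨-, rfl⟩, hd⟩ := StateTransition.tr_eval
    (TM0.Machine.map_respects M idm idm ⟨g, by simp only [g, dif_pos ss.1]; rfl⟩ Subtype.val ss
      (fun _ ↦ rfl) (fun q hq ↦ by
        change (g q).val = q
        simp [g, hq])) (a₁ := TM0.init l) ⟨ss.1, rfl⟩ hc
  refine ⟨g c.q, ?_⟩
  convert! hd using 1
  · exact congrArg (StateTransition.eval _) (congrArg₂ TM0.Cfg.mk (dif_pos ss.1).symm (hmap _).symm)
  · exact congrArg (TM0.Cfg.mk _) (hmap _).symm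

theorem length_trInit_le {K : Type} [DecidableEq K] {Γ : K → Type} (k : K) (L : List (Γ k)) :
    (TM2to1.trInit k L).length ≤ L.length + 1 := by
  refine (Nat.succ_le_succ (List.tail_sublist _).length_le).trans ?_
  exact Nat.succ_le_succ ((List.length_map _).trans List.length_reverse).le

/-- A finitely supported `TM2` machine is simulated by a finite `TM0` machine over `Bool`; the
constant `n` relating the sizes of the inputs only depends on the stack alphabets. -/
theorem TM2.exists_finite_TM0 (K : Type) [DecidableEq K] [Fintype K] (Γ : K → Type)
    [∀ k, Fintype (Γ k)] :
    ∃ n : ℕ, ∀ (Λ σ : Type) [Inhabited Λ] [Inhabited σ] [Fintype σ] (M : Λ → TM2.Stmt Γ Λ σ)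
      (S : Finset Λ) (_ : TM2.Supports M S) (k : K),
      ∃ (Q : Type) (_ : Inhabited Q) (_ : Finite Q) (M₀ : TM0.Machine Bool Q),
        ∀ (L : List (Γ k)) (c : TM2.Cfg Γ Λ σ),
          c ∈ StateTransition.eval (TM2.step M) (TM2.init k L) → c.stk k ≠ [] →
          ∃ l : List Bool, l.length ≤ n * (L.length + 1) ∧
            ∃ c₀ ∈ StateTransition.eval (TM0.step M₀) (TM0.init l),
              ∃ j : ℕ, (c.stk k).length ≤ j + 1 ∧ c₀.Tape.nth j = true := by
  obtain ⟨n, enc, dec, enc0, encdec⟩ := TM1to1.exists_enc_dec (Γ := TM2to1.Γ' K Γ)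
  refine ⟨n, fun Λ σ _ _ _ M S ss k ↦ ?_⟩
  have ss₁ := TM2to1.tr_supports M ss
  have ss₂ := TM1to1.tr_supports enc dec (TM2to1.tr M) ss₁
  have ss₃ := TM1to0.tr_supports _ ss₂
  obtain ⟨Q, iQ, fQ, M₀, hM₀⟩ := TM0.exists_finite_machine _ (Finset.finite_toSet _) ss₃
  refine ⟨Q, iQ, fQ, M₀, fun L c hc hne ↦
    ⟨(TM2to1.trInit k L).flatMap fun a ↦ (enc a).toList, ?_, ?_⟩⟩
  · simp only [List.length_flatMap, List.Vector.toList_length, List.map_const', List.sum_replicate,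
      smul_eq_mul]
    rw [mul_comm]
    exact Nat.mul_le_mul_left _ (length_trInit_le k L)
  · obtain ⟨_, @⟨q', v, S', L', hL'⟩, h₁⟩ := StateTransition.tr_eval (TM2to1.tr_respects M)
      (TM2to1.trCfg_init k L) hc
    obtain ⟨_, rfl, h₂⟩ := StateTransition.tr_eval
      (TM1to1.tr_respects dec (TM2to1.tr M) (enc0 := enc0) encdec) rfl h₁
    obtain ⟨_, rfl, h₃⟩ := StateTransition.tr_eval (TM1to0.tr_respects _) rfl h₂
    obtain ⟨q, hq⟩ := hM₀ ((TM2to1.trInit k L).flatMap fun a ↦ (enc a).toList) _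
      (by convert! h₃ using 2)
    have hblank : (TM2to1.addBottom L').nth ((S' k).length - 1) ≠ default := by
      intro h
      have h' : L'.nth ((S' k).length - 1) k = none := by
        rw [← TM2to1.addBottom_nth_snd, h]
        rfl
      rw [TM2to1.stk_nth_val _ (hL' k), List.getElem?_eq_none_iff, List.length_reverse] at h'
      have := List.length_pos_iff.2 hne
      change 0 < (S' k).length at this
      omega
    have htrue : ∀ a, a ≠ default → true ∈ (enc a).toList := by
      intro a ha
      contrapose! ha
      rw [← encdec a, ← encdec default]
      congr 1
      rw [enc0]
      refine List.Vector.toList_injective ?_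
      change _ = List.replicate n false
      exact List.eq_replicate_iff.2 ⟨(enc a).toList_length, fun b hb ↦ by cases b <;> simp_all⟩
    obtain ⟨j, hj, hj'⟩ := ListBlank.exists_nth_flatMap (f := fun a ↦ (enc a).toList)
      (fun a ↦ (enc a).toList_length) ⟨n, by rw [enc0]; rfl⟩ htrue hblank
    refine ⟨_, hq, j, by change (S' k).length ≤ j + 1; omega, ?_⟩
    rw [← hj']
    change Tape.nth (TM1to1.trTape enc0 (Tape.mk' _ _)) _ = _
    rw [TM1to1.trTape_mk', TM1to1.trTape', Tape.mk'_nth_nat]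

end Turing

namespace Turing

namespace PartrecToTM2

instance : Fintype K' :=
  ⟨{K'.main, K'.rev, K'.aux, K'.stack}, fun x ↦ by cases x <;> decide⟩

theorem length_trPosNum_le (p : PosNum) : (trPosNum p).length ≤ p := by
  induction p with
  | one => simp [trPosNum]
  | bit0 p ih =>
    have := p.cast_pos (α := ℕ)
    simp only [trPosNum, List.length_cons, PosNum.cast_bit0]
    omega
  | bit1 p ih =>
    simp only [trPosNum, List.length_cons, PosNum.cast_bit1]
    have := p.cast_pos (α := ℕ)
    omega

theorem lt_two_pow_length_trPosNum (p : PosNum) : (p : ℕ) < 2 ^ (trPosNum p).length := by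
  induction p with
  | one => simp [trPosNum]
  | bit0 p ih =>
    simp only [trPosNum, List.length_cons, PosNum.cast_bit0, pow_succ]
    omega
  | bit1 p ih =>
    simp only [trPosNum, List.length_cons, PosNum.cast_bit1, pow_succ]
    omega

theorem length_trNat_le (n : ℕ) : (trNat n).length ≤ n := by
  unfold trNat
  conv_rhs => rw [← Num.to_of_nat n]
  cases (n : Num) with
  | zero => exact le_rfl
  | pos p => exact length_trPosNum_le p

theorem lt_two_pow_length_trNat (n : ℕ) : n < 2 ^ (trNat n).length := by
  unfold trNat
  conv_lhs => rw [← Num.to_of_nat n]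
  cases (n : Num) with
  | zero => exact Nat.one_pos
  | pos p => exact lt_two_pow_length_trPosNum p

/-- A computable function is computed by finite `TM0` machines over `Bool`, with inputs of size
linear in the argument, and so that the last nonblank cell of the output is at a position at least
the binary length of the value; the constant `n` does not depend on the function. -/
theorem exists_finite_TM0_of_computable :
    ∃ n : ℕ, ∀ F : ℕ → ℕ, Computable F →
      ∃ (Q : Type) (_ : Inhabited Q) (_ : Finite Q) (M : TM0.Machine Bool Q),
        ∀ k, ∃ l : List Bool, l.length ≤ n * (k + 2) ∧
          ∃ c ∈ StateTransition.eval (TM0.step M) (TM0.init l),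
            ∃ j : ℕ, F k < 2 ^ j ∧ c.Tape.nth j = true := by
  obtain ⟨n, hn⟩ := TM2.exists_finite_TM0 K' fun _ ↦ Γ'
  refine ⟨n, fun F hF ↦ ?_⟩
  obtain ⟨c, hc⟩ := ToPartrec.Code.exists_code (Nat.Partrec'.part_iff₁.2 hF.partrec)
  obtain ⟨Q, iQ, fQ, M, hM⟩ :=
    @hn Λ' (Option Γ') ⟨trNormal c Cont'.halt⟩ ⟨none⟩ _ tr _ (tr_supports c Cont'.halt) K'.main
  refine ⟨Q, iQ, fQ, M, fun k ↦ ?_⟩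
  have hk : halt [F k] ∈ StateTransition.eval (TM2.step tr) (init c [k]) := by
    rw [tr_eval]
    have := hc ⟨[k], rfl⟩
    refine (Part.mem_map_iff _).2 ⟨[F k], ?_, rfl⟩
    change c.eval [k] = _ at this
    rw [this]
    simp [List.Vector.head]
  have hinit : init c [k] =
      @TM2.init K' (fun _ ↦ Γ') Λ' (Option Γ') ⟨trNormal c Cont'.halt⟩ _ ⟨none⟩ K'.main
        (trList [k]) :=
    congrArg (TM2.Cfg.mk _ _) (funext fun x ↦ by cases x <;> rfl)
  obtain ⟨l, hl, c₀, hc₀, j, hj, hj'⟩ := hM (trList [k]) (halt [F k]) (hinit ▸ hk)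
    (by simp [halt, trList])
  refine ⟨l, hl.trans (Nat.mul_le_mul_left _ ?_), c₀, hc₀, j, ?_, hj'⟩
  · have := length_trNat_le k
    simp [trList]
    omega
  · refine (lt_two_pow_length_trNat (F k)).trans_le (Nat.pow_le_pow_right two_pos ?_)
    simpa [halt, trList] using hj

end PartrecToTM2

end Turing

/-- Non-computability of the longest output: no computable function agrees, on all `k ≥ 1`,
with the length of the longest string `s` with `m_k(s) > 0`. -/
theorem longestLen_not_computable :
    ¬ ∃ f : ℕ → ℕ, Computable f ∧ ∀ k, 1 ≤ k → f k = longestLen k := by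
  rintro ⟨f, hf, hlen⟩
  obtain ⟨n, hn⟩ := Turing.PartrecToTM2.exists_finite_TM0_of_computable
  have hpow : Primrec₂ fun a b : ℕ ↦ a ^ b := Primrec₂.unpaired'.1 Nat.Primrec.pow
  have harg : Primrec fun k : ℕ ↦ n * (k + 2) + 1 + k :=
    Primrec.nat_add.comp (Primrec.succ.comp (Primrec.nat_mul.comp (Primrec.const n)
      (Primrec.nat_add.comp Primrec.id (Primrec.const 2)))) Primrec.id
  obtain ⟨Q, _, _, M, hM⟩ := hn (fun k ↦ 2 ^ f (n * (k + 2) + 1 + k))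
    (hpow.to_comp.comp (Computable.const 2) (hf.comp harg.to_comp))
  obtain ⟨l, hl, c, hc, j, hj, hj'⟩ := hM (Nat.card (Q × Bool))
  obtain ⟨τ, s, hτ, hs⟩ := Turing.exists_outputs_of_mem_eval M l hc hj'
  have hj₂ := (Nat.pow_lt_pow_iff_right (Nat.le_refl 2)).1 hj
  have := length_le_longestLen (k := n * (Nat.card (Q × Bool) + 2) + 1 + Nat.card (Q × Bool))
    (by omega) (by omega) (List.ne_nil_of_length_pos (by omega)) hτ
  rw [← hlen _ (by omega)] at this
  omega
end
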